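/- Let (X,d) be a separable metric space with its Borel σ-algebra, μ a probability measure on X, and l : X → {−1,1} a measurable labeling function. Let x_1,…,x_n be i.i.d. with law μ, labeled by y_i = l(x_i), and suppose both labels occur in the sample. For z in the sample, let d_enemy(z) be the minimum distance from z to a sample point of opposite label. Then for every n ∈ ℕ and 0 < δ < 1, with probability at least 1 − δ over the sample the following holds simultaneously for every nonempty index set S̃ ⊆ {1,…,n} with |S̃| < n: if the WNN classifier h determined by S̃ with weights w(j) = d_enemy(x_j) satisfies h(x_i) = y_i for all i ∈ {1,…,n}, then μ{x ∈ X : h(x) ≠ l(x)} ≤ (2/(n−|S̃|)) · (|S̃|·log(2en/|S̃|) + log(n/δ)). -/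

import Mathlib

open MeasureTheory

/-- The distance from `xs j` to the nearest point of the opposite label among `xs i`, `i ∈ E`. -/
noncomputable def enemyDist {X ι : Type*} [MetricSpace X] (l : X → Bool) (E : Finset ι)
    (xs : ι → X) (j : ι) : ℝ :=
  (⨅ i ∈ E, if l (xs i) = l (xs j) then (⊤ : ENNReal) else edist (xs j) (xs i)).toReal

/-- The index `j` wins the weighted nearest neighbour competition at `z` among the indices in `S`,
the weights being the distances to the nearest enemy in `E`. -/
def IsWinner {X ι : Type*} [MetricSpace X] [LinearOrder ι] (l : X → Bool) (S E : Finset ι)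
    (xs : ι → X) (z : X) (j : ι) : Prop :=
  (∀ k ∈ S, dist z (xs j) / enemyDist l E xs j ≤ dist z (xs k) / enemyDist l E xs k) ∧
    ∀ k ∈ S, dist z (xs k) / enemyDist l E xs k = dist z (xs j) / enemyDist l E xs j → j ≤ k

/-- The pairs of a sample and a point that is correctly classified from the sample points
with index in `S` and the enemies with index in `E`. -/
def agreement {X ι : Type*} [MetricSpace X] [LinearOrder ι] (l : X → Bool) (S E : Finset ι) :
    Set ((ι → X) × X) :=
  {p | ∃ j ∈ S, l p.2 = l (p.1 j) ∧ IsWinner l S E p.1 p.2 j}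

section Agreement

variable {X ι : Type*} [MetricSpace X]

lemma enemyDist_eq_of_isLeast {l : X → Bool} {E : Finset ι} {xs : ι → X} {j e : ι} {w : ℝ}
    (hw : IsLeast {r : ℝ | ∃ i, l (xs i) ≠ l (xs j) ∧ r = dist (xs j) (xs i)} w)
    (heE : e ∈ E) (hne : l (xs e) ≠ l (xs j)) (he : w = dist (xs j) (xs e)) :
    enemyDist l E xs j = w := by
  have h : (⨅ i ∈ E, if l (xs i) = l (xs j) then (⊤ : ENNReal) else edist (xs j) (xs i))
      = edist (xs j) (xs e) := by
    apply le_antisymm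
    · exact (iInf₂_le e heE).trans (by simp [hne])
    · refine le_iInf₂ fun i _ => ?_
      split_ifs with hi
      · exact le_top
      · rw [edist_dist, edist_dist, ← he]
        exact ENNReal.ofReal_le_ofReal (hw.2 ⟨i, hi, rfl⟩)
  rw [enemyDist, h, he, edist_dist, ENNReal.toReal_ofReal dist_nonneg]

lemma enemyDist_congr (l : X → Bool) {E : Finset ι} {xs ys : ι → X} {j : ι}
    (hj : xs j = ys j) (hE : ∀ i ∈ E, xs i = ys i) :
    enemyDist l E xs j = enemyDist l E ys j := by
  unfold enemyDist
  congr 1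
  refine iInf_congr fun i => iInf_congr fun hi => ?_
  rw [hj, hE i hi]

lemma measurable_enemyDist [MeasurableSpace X] [BorelSpace X]
    [SecondCountableTopology X] {l : X → Bool} (hl : Measurable l) (E : Finset ι) (j : ι) :
    Measurable fun xs : ι → X => enemyDist l E xs j := by
  refine Measurable.ennreal_toReal (Measurable.biInf _ E.countable_toSet fun i _ => ?_)
  refine Measurable.ite (measurableSet_eq_fun ?_ ?_) measurable_const ?_ <;> fun_prop

variable [LinearOrder ι]

lemma mem_agreement_congr (l : X → Bool) {S E : Finset ι} {xs ys : ι → X}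
    (h : ∀ i ∈ S ∪ E, xs i = ys i) (z : X) :
    (xs, z) ∈ agreement l S E ↔ (ys, z) ∈ agreement l S E := by
  have hS : ∀ i ∈ S, xs i = ys i := fun i hi => h i (Finset.mem_union_left _ hi)
  have hE : ∀ i ∈ E, xs i = ys i := fun i hi => h i (Finset.mem_union_right _ hi)
  have hd : ∀ i ∈ S, enemyDist l E xs i = enemyDist l E ys i :=
    fun i hi => enemyDist_congr l (hS i hi) hE
  simp only [agreement, IsWinner, Set.mem_ofPred_eq]
  refine exists_congr fun j => and_congr_right fun hj => ?_
  rw [hS j hj, hd j hj]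
  refine and_congr_right fun _ => and_congr ?_ ?_ <;>
  · refine forall₂_congr fun k hk => ?_
    rw [hS k hk, hd k hk]

lemma IsWinner.unique {l : X → Bool} {S E : Finset ι} {xs : ι → X} {z : X} {i j : ι}
    (hi : IsWinner l S E xs z i) (hj : IsWinner l S E xs z j) (hiS : i ∈ S) (hjS : j ∈ S) :
    i = j :=
  have h := le_antisymm (hi.1 j hjS) (hj.1 i hiS)
  le_antisymm (hi.2 j hjS h.symm) (hj.2 i hiS h)

variable [MeasurableSpace X] [BorelSpace X] [SecondCountableTopology X]

lemma measurableSet_agreement {l : X → Bool} (hl : Measurable l) (S E : Finset ι) :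
    MeasurableSet (agreement l S E : Set ((ι → X) × X)) := by
  have hd : ∀ j, Measurable fun p : (ι → X) × X => dist p.2 (p.1 j) / enemyDist l E p.1 j :=
    fun j => Measurable.div (by fun_prop) ((measurable_enemyDist hl E j).comp measurable_fst)
  have : agreement l S E = ⋃ j ∈ S, ({p : (ι → X) × X | l p.2 = l (p.1 j)} ∩
      ((⋂ k ∈ S, {p : (ι → X) × X | dist p.2 (p.1 j) / enemyDist l E p.1 j ≤
          dist p.2 (p.1 k) / enemyDist l E p.1 k}) ∩
        ⋂ k ∈ S, ({p : (ι → X) × X | dist p.2 (p.1 k) / enemyDist l E p.1 k =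
          dist p.2 (p.1 j) / enemyDist l E p.1 j}ᶜ ∪ {_p | j ≤ k}))) := by
    ext p
    simp [agreement, IsWinner, imp_iff_not_or, and_left_comm]
  rw [this]
  refine S.measurableSet_biUnion fun j _ => ?_
  refine (measurableSet_eq_fun (by fun_prop) (by fun_prop)).inter (MeasurableSet.inter ?_ ?_)
  · exact S.measurableSet_biInter fun k _ => measurableSet_le (hd j) (hd k)
  · exact S.measurableSet_biInter fun k _ =>
      (measurableSet_eq_fun (hd k) (hd j)).compl.union (MeasurableSet.const _)

end Agreement

/-- A hypothesis that depends only on the coordinates in `T` and whose accuracy is below `c`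
is correct on all remaining coordinates with probability at most `c ^ (|ι| - |T|)`. -/
lemma measure_pi_consistent_le {X ι : Type*} [Fintype ι] [DecidableEq ι] [MeasurableSpace X]
    (μ : Measure X) [IsProbabilityMeasure μ] (T : Finset ι) {G : Set ((ι → X) × X)}
    (hG : MeasurableSet G)
    (hT : ∀ xs ys : ι → X, (∀ i ∈ T, xs i = ys i) → ∀ z, ((xs, z) ∈ G ↔ (ys, z) ∈ G))
    (c : ENNReal) :
    (Measure.pi fun _ : ι => μ)
      {xs | (∀ i ∉ T, (xs, xs i) ∈ G) ∧ μ {z | (xs, z) ∈ G} < c} ≤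
        c ^ (Fintype.card ι - T.card) := by
  obtain ⟨x₀⟩ : Nonempty X := nonempty_of_isProbabilityMeasure μ
  let ext : ({i // i ∈ T} → X) → ι → X := fun t i => if h : i ∈ T then t ⟨i, h⟩ else x₀
  have hext : Measurable ext := by
    refine measurable_pi_lambda _ fun i => ?_
    by_cases h : i ∈ T
    · simpa [ext, h] using measurable_pi_apply (⟨i, h⟩ : {i // i ∈ T})
    · simp [ext, h]
  let B : Set (({i // i ∈ T} → X) × ({i // i ∉ T} → X)) :=
    (⋂ i, {p | (ext p.1, p.2 i) ∈ G}) ∩ {p | μ {z | (ext p.1, z) ∈ G} < c}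
  have hB : MeasurableSet B := by
    refine MeasurableSet.inter (MeasurableSet.iInter fun i => ?_) ?_
    · exact hG.preimage ((hext.comp measurable_fst).prodMk
        ((measurable_pi_apply i).comp measurable_snd))
    · exact measurableSet_lt
        ((measurable_measure_prodMk_left hG).comp (hext.comp measurable_fst)) measurable_const
  have hmp := measurePreserving_piEquivPiSubtypeProd (fun _ : ι => μ) (fun i => i ∈ T)
  have hsub : {xs : ι → X | (∀ i ∉ T, (xs, xs i) ∈ G) ∧ μ {z | (xs, z) ∈ G} < c} =
      (MeasurableEquiv.piEquivPiSubtypeProd (fun _ : ι => X) (fun i => i ∈ T)) ⁻¹' B := by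
    ext xs
    have key : ∀ z, (xs, z) ∈ G ↔ (ext (fun i => xs i), z) ∈ G :=
      hT _ _ (fun i hi => by simp [ext, hi])
    simp only [Set.mem_ofPred_eq, key]
    simp [B, MeasurableEquiv.piEquivPiSubtypeProd, Equiv.piEquivPiSubtypeProd]
  rw [hsub, hmp.measure_preimage hB.nullMeasurableSet, Measure.prod_apply hB]
  calc _ ≤ ∫⁻ _, c ^ (Fintype.card ι - T.card) ∂_ := by
        refine lintegral_mono fun t => ?_
        by_cases ht : μ {z | (ext t, z) ∈ G} < c
        · have : Prod.mk t ⁻¹' B = Set.univ.pi fun _ : {i // i ∉ T} => {z | (ext t, z) ∈ G} := by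
            ext u
            simp [B, ht]
          rw [this, Measure.pi_pi]
          simp only [Finset.prod_const, Finset.card_univ, Fintype.card_subtype_compl,
            Fintype.card_coe]
          exact pow_le_pow_left' ht.le _
        · have : Prod.mk t ⁻¹' B = ∅ := by
            ext u
            simp [B, not_lt.1 ht]
          simp [this]
    _ = _ := by simp

lemma choose_le_exp_mul_div_pow (n k : ℕ) (hk : 0 < k) :
    (n.choose k : ℝ) ≤ (Real.exp 1 * n / k) ^ k := by
  have h₁ : (n.choose k : ℝ) ≤ (n : ℝ) ^ k / k.factorial := Nat.choose_le_pow_div k n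
  have h₂ : (k : ℝ) ^ k / k.factorial ≤ Real.exp k :=
    Real.pow_div_factorial_le_exp _ (Nat.cast_nonneg k) k
  have hk' : (0 : ℝ) < k := Nat.cast_pos.2 hk
  calc (n.choose k : ℝ) ≤ (n : ℝ) ^ k / k.factorial := h₁
    _ = (n / k : ℝ) ^ k * ((k : ℝ) ^ k / k.factorial) := by rw [div_pow]; field_simp
    _ ≤ (n / k : ℝ) ^ k * Real.exp k := by gcongr
    _ = (Real.exp 1 * n / k) ^ k := by
      rw [← Real.exp_one_pow, ← mul_pow]; ring

lemma errorBound_nonneg {n k : ℕ} {δ : ℝ} (hk : 0 < k) (hkn : k < n) (hδ0 : 0 < δ)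
    (hδ1 : δ < 1) :
    0 ≤ 2 / ((n : ℝ) - k) * (k * Real.log (2 * Real.exp 1 * n / k) + Real.log (n / δ)) := by
  have hkn' : (k : ℝ) < n := Nat.cast_lt.2 hkn
  have hk' : (1 : ℝ) ≤ k := by exact_mod_cast hk
  have : 0 < (n : ℝ) - k := by linarith
  refine mul_nonneg (by positivity) (add_nonneg (mul_nonneg (by positivity) ?_) ?_)
  · apply Real.log_nonneg
    rw [le_div_iff₀ (by linarith)]
    have := Real.add_one_le_exp (1 : ℝ)
    nlinarith
  · apply Real.log_nonneg
    rw [le_div_iff₀ hδ0]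
    linarith

/-- The union bound over all pairs of index sets of size `k`. -/
lemma choose_sq_mul_pow_le {n k m : ℕ} {δ ε : ℝ} (hk : 0 < k) (hkn : k < n) (hm : n ≤ m + 2 * k)
    (hδ0 : 0 < δ) (hδ1 : δ < 1)
    (hε : ε = 2 / ((n : ℝ) - k) *
      (k * Real.log (2 * Real.exp 1 * n / k) + Real.log (n / δ))) (hε1 : ε < 1) :
    (n.choose k : ℝ) ^ 2 * (1 - ε) ^ m ≤ δ / n := by
  have hk' : (0 : ℝ) < k := Nat.cast_pos.2 hk
  have hn' : (0 : ℝ) < n := Nat.cast_pos.2 (hk.trans hkn)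
  have hkn' : (k : ℝ) < n := Nat.cast_lt.2 hkn
  have hm' : (n : ℝ) ≤ m + 2 * k := by exact_mod_cast hm
  set a := Real.exp 1 * n / k with ha
  have ha0 : 0 < a := by positivity
  have hL : Real.log (2 * Real.exp 1 * n / k) = Real.log 2 + Real.log a := by
    rw [← Real.log_mul two_ne_zero ha0.ne', ha]; congr 1; ring
  have hA : 0 ≤ Real.log (n / δ) := by
    apply Real.log_nonneg
    rw [le_div_iff₀ hδ0]
    have : (1 : ℝ) ≤ n := by exact_mod_cast (hk.trans hkn)
    linarith
  have hlog2 := Real.log_two_gt_d9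
  have hε0 : 0 ≤ ε := hε ▸ errorBound_nonneg hk hkn hδ0 hδ1
  rw [hL] at hε
  have hεn : ε * (n - k) = 2 * (k * (Real.log 2 + Real.log a) + Real.log (n / δ)) := by
    rw [hε]
    have : (n : ℝ) - k ≠ 0 := by linarith
    field_simp
  have hexp : 2 * (k * Real.log a) - ε * m ≤ - Real.log (n / δ) := by
    nlinarith [mul_le_mul_of_nonneg_left hm' hε0, mul_lt_mul_of_pos_left hε1 hk']
  calc (n.choose k : ℝ) ^ 2 * (1 - ε) ^ m
      ≤ (a ^ k) ^ 2 * (Real.exp (-ε)) ^ m := by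
        gcongr
        · exact choose_le_exp_mul_div_pow n k hk
        · have := Real.add_one_le_exp (-ε); linarith
    _ = Real.exp (2 * (k * Real.log a) - ε * m) := by
        rw [← Real.exp_log ha0, ← Real.exp_nat_mul, ← Real.exp_nat_mul, ← Real.exp_nat_mul,
          ← Real.exp_add, Real.log_exp]
        congr 1
        push_cast
        ring
    _ ≤ Real.exp (- Real.log (n / δ)) := Real.exp_le_exp.2 hexp
    _ = δ / n := by
        rw [Real.exp_neg, Real.exp_log (by positivity), inv_div]

/-- The samples on which the classifier built from `S` and `E` is consistent outside `S ∪ E`,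
but has error larger than `ε`. -/
def badSamples {X : Type*} [MetricSpace X] [MeasurableSpace X] (μ : Measure X) (l : X → Bool)
    {n : ℕ} (ε : ℝ) (S E : Finset (Fin n)) : Set (Fin n → X) :=
  {xs | (∀ i ∉ S ∪ E, (xs, xs i) ∈ agreement l S E) ∧
    μ {z | (xs, z) ∈ agreement l S E} < ENNReal.ofReal (1 - ε)}

lemma measure_biUnion_badSamples_le {X : Type*} [MetricSpace X] [SecondCountableTopology X]
    [MeasurableSpace X] [BorelSpace X] (μ : Measure X) [IsProbabilityMeasure μ]
    {l : X → Bool} (hl : Measurable l) {n k : ℕ} {δ ε : ℝ} (hk : 0 < k) (hkn : k < n)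
    (hδ0 : 0 < δ) (hδ1 : δ < 1)
    (hε : ε = 2 / ((n : ℝ) - k) *
      (k * Real.log (2 * Real.exp 1 * n / k) + Real.log (n / δ))) :
    (Measure.pi fun _ : Fin n => μ)
      (⋃ p ∈ Finset.univ.powersetCard k ×ˢ Finset.univ.powersetCard k,
        badSamples μ l ε p.1 p.2) ≤ ENNReal.ofReal (δ / n) := by
  rcases le_or_gt 1 ε with h1 | h1
  · have : ENNReal.ofReal (1 - ε) = 0 := ENNReal.ofReal_of_nonpos (by linarith)
    simp [badSamples, this]
  have hε0 : 0 ≤ ε := hε ▸ errorBound_nonneg hk hkn hδ0 hδ1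
  have hone : ∀ p ∈ (Finset.univ : Finset (Fin n)).powersetCard k ×ˢ Finset.univ.powersetCard k,
      (Measure.pi fun _ : Fin n => μ) (badSamples μ l ε p.1 p.2) ≤
        ENNReal.ofReal (1 - ε) ^ (n - 2 * k) := by
    rintro ⟨S, E⟩ hp
    simp only [Finset.mem_product, Finset.mem_powersetCard_univ] at hp
    refine (measure_pi_consistent_le μ (S ∪ E) (measurableSet_agreement hl S E)
      (fun _ _ h z => mem_agreement_congr l h z) _).trans ?_
    have hcard := Finset.card_union_le S E
    refine pow_le_pow_right_of_le_one' ?_ ?_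
    · rw [← ENNReal.ofReal_one]
      exact ENNReal.ofReal_le_ofReal (by linarith)
    · rw [Fintype.card_fin]; omega
  calc _ ≤ ∑ p ∈ (Finset.univ : Finset (Fin n)).powersetCard k ×ˢ Finset.univ.powersetCard k,
        (Measure.pi fun _ : Fin n => μ) (badSamples μ l ε p.1 p.2) := measure_biUnion_finset_le _ _
    _ ≤ _ := Finset.sum_le_card_nsmul _ _ _ hone
    _ = ENNReal.ofReal ((n.choose k : ℝ) ^ 2 * (1 - ε) ^ (n - 2 * k)) := by
      rw [ENNReal.ofReal_mul (by positivity), ENNReal.ofReal_pow (by linarith),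
        ENNReal.ofReal_pow (by positivity), ENNReal.ofReal_natCast]
      simp [sq]
    _ ≤ _ := ENNReal.ofReal_le_ofReal
      (choose_sq_mul_pow_le hk hkn (by omega) hδ0 hδ1 hε h1)

/-- A consistent weighted nearest neighbour classifier with large error witnesses that the sample
is bad for some set of enemies of the same size as the set of prototypes. -/
lemma exists_mem_badSamples {X : Type*} [MetricSpace X] [SecondCountableTopology X]
    [MeasurableSpace X] [BorelSpace X] (μ : Measure X) [IsProbabilityMeasure μ]
    {l : X → Bool} (hl : Measurable l) {n : ℕ} {ε : ℝ} {xs : Fin n → X} {S : Finset (Fin n)}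
    {w : Fin n → ℝ} {h : X → Bool}
    (hw : ∀ j ∈ S, IsLeast
      {r : ℝ | ∃ i : Fin n, l (xs i) ≠ l (xs j) ∧ r = dist (xs j) (xs i)} (w j))
    (hh : ∀ z : X, ∃ j ∈ S, h z = l (xs j) ∧
      (∀ k ∈ S, dist z (xs j) / w j ≤ dist z (xs k) / w k) ∧
      (∀ k ∈ S, dist z (xs k) / w k = dist z (xs j) / w j → j ≤ k))
    (hcons : ∀ i : Fin n, h (xs i) = l (xs i)) (herr : ε < (μ {x | h x ≠ l x}).toReal) :
    ∃ E : Finset (Fin n), E.card = S.card ∧ xs ∈ badSamples μ l ε S E := by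
  choose! e he using fun j hj => (hw j hj).1
  obtain ⟨E, hsub, hE⟩ := Finset.exists_superset_card_eq (s := S.image e) (n := S.card)
    Finset.card_image_le (by simpa using S.card_le_univ)
  have hd : ∀ j ∈ S, enemyDist l E xs j = w j := fun j hj =>
    enemyDist_eq_of_isLeast (hw j hj) (hsub (Finset.mem_image_of_mem e hj)) (he j hj).1 (he j hj).2
  have hwin : ∀ z, ∃ j ∈ S, h z = l (xs j) ∧ IsWinner l S E xs z j := by
    intro z
    obtain ⟨j, hj, hz, h₁, h₂⟩ := hh z
    refine ⟨j, hj, hz, fun k hk => ?_, fun k hk => ?_⟩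
    · rw [hd j hj, hd k hk]; exact h₁ k hk
    · rw [hd j hj, hd k hk]; exact h₂ k hk
  have hiff : ∀ z, (xs, z) ∈ agreement l S E ↔ h z = l z := by
    intro z
    obtain ⟨j, hj, hz, hwj⟩ := hwin z
    constructor
    · rintro ⟨i, hi, hli, hwi⟩
      rw [hz, hwj.unique hwi hj hi]
      exact hli.symm
    · intro hzl
      exact ⟨j, hj, hzl.symm.trans hz, hwj⟩
  refine ⟨E, hE, fun i _ => (hiff _).2 (hcons i), ?_⟩
  have hmeas : MeasurableSet {z | h z = l z} := by
    have := (measurableSet_agreement hl S E).preimage (measurable_prodMk_left (x := xs))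
    simpa only [Set.preimage, hiff] using this
  simp only [hiff]
  have hcompl : {x | h x ≠ l x} = {z | h z = l z}ᶜ := rfl
  rw [hcompl, ← measureReal_def, probReal_compl_eq_one_sub hmeas] at herr
  rw [ENNReal.lt_ofReal_iff_toReal_lt (measure_ne_top _ _), ← measureReal_def]
  linarith

/-- Generalization bound for consistent WNN classifiers with nearest-enemy weights
(Theorem 3, permutation-invariant case).  The sample is `n` i.i.d. points with law `μ`
(encoded by the product measure), labeled by `l`; both labels are assumed to occur in
the sample.  The weight of `x_j` is `d_enemy(x_j)`, the minimum distance to a sample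
point of the opposite label (expressed via `IsLeast`).  With probability at least
`1 - δ`, every consistent such classifier with `|S̃| < n` has error at most
`(2/(n-|S̃|))·(|S̃|·log(2en/|S̃|) + log(n/δ))`. -/
theorem stmt5 {X : Type*} [MetricSpace X] [TopologicalSpace.SeparableSpace X]
    [MeasurableSpace X] [BorelSpace X]
    (μ : Measure X) [IsProbabilityMeasure μ]
    (l : X → Bool) (hl : Measurable l)
    (n : ℕ) (hn : 0 < n) (δ : ℝ) (hδ0 : 0 < δ) (hδ1 : δ < 1) :
    1 - ENNReal.ofReal δ ≤
      (Measure.pi fun _ : Fin n => μ)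
        {xs : Fin n → X |
          ((∃ i, l (xs i) = true) ∧ (∃ i, l (xs i) = false)) →
          ∀ (St : Finset (Fin n)) (w : Fin n → ℝ) (h : X → Bool),
            St.Nonempty → St.card < n →
            (∀ j ∈ St, IsLeast
              {r : ℝ | ∃ i : Fin n, l (xs i) ≠ l (xs j) ∧ r = dist (xs j) (xs i)}
              (w j)) →
            (∀ z : X, ∃ j ∈ St, h z = l (xs j) ∧
              (∀ k ∈ St, dist z (xs j) / w j ≤ dist z (xs k) / w k) ∧
              (∀ k ∈ St, dist z (xs k) / w k = dist z (xs j) / w j → j ≤ k)) →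
            (∀ i : Fin n, h (xs i) = l (xs i)) →
            (μ {x | h x ≠ l x}).toReal ≤
              2 / ((n : ℝ) - St.card) *
                (St.card * Real.log (2 * Real.exp 1 * n / St.card) +
                  Real.log (n / δ))} := by
  have : SecondCountableTopology X := UniformSpace.secondCountable_of_separable X
  set ν := Measure.pi fun _ : Fin n => μ with hν
  set good : Set (Fin n → X) := {xs : Fin n → X | _} with hgood
  let ε : ℕ → ℝ := fun k => 2 / ((n : ℝ) - k) *
    (k * Real.log (2 * Real.exp 1 * n / k) + Real.log (n / δ))
  have hbad : goodᶜ ⊆ ⋃ k ∈ Finset.Ioo 0 n,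
      ⋃ p ∈ Finset.univ.powersetCard k ×ˢ Finset.univ.powersetCard k,
        badSamples μ l (ε k) p.1 p.2 := by
    intro xs hxs
    rw [hgood, Set.mem_compl_iff, Set.mem_ofPred_eq] at hxs
    push Not at hxs
    obtain ⟨-, S, w, h, hS, hSn, hw, hh, hcons, herr⟩ := hxs
    obtain ⟨E, hE, hmem⟩ := exists_mem_badSamples μ hl hw hh hcons herr
    simp only [Set.mem_iUnion]
    exact ⟨S.card, Finset.mem_Ioo.2 ⟨hS.card_pos, hSn⟩, (S, E), by simp [hE], hmem⟩
  have hδ : ν goodᶜ ≤ ENNReal.ofReal δ := by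
    calc ν goodᶜ ≤ _ := measure_mono hbad
      _ ≤ _ := measure_biUnion_finset_le _ _
      _ ≤ _ := Finset.sum_le_card_nsmul _ _ (ENNReal.ofReal (δ / n)) fun k hk =>
        measure_biUnion_badSamples_le μ hl (Finset.mem_Ioo.1 hk).1 (Finset.mem_Ioo.1 hk).2
          hδ0 hδ1 rfl
      _ ≤ n • ENNReal.ofReal (δ / n) := by
        refine nsmul_le_nsmul_left zero_le ?_
        simp
      _ = ENNReal.ofReal δ := by
        rw [← ENNReal.ofReal_nsmul, nsmul_eq_mul, mul_div_cancel₀]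
        exact_mod_cast hn.ne'
  rw [tsub_le_iff_right]
  calc (1 : ENNReal) = ν Set.univ := measure_univ.symm
    _ ≤ ν good + ν goodᶜ := measure_univ_le_add_compl good
    _ ≤ ν good + ENNReal.ofReal δ := by gcongr
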